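/- For every integer j (positive, negative or zero) and real q with 0 < q < 1, one has ∫_0^π e^{2ijθ} (e^{2iθ}; q)_∞ (e^{-2iθ}; q)_∞ dθ/(2π) = (-1)^j (q^{j(j-1)/2} + q^{j(j+1)/2}) / (2 (q;q)_∞). -/

import Mathlib

open Complex intervalIntegral

/-- Infinite q-shifted factorial `(a;q)_∞`. -/
noncomputable def qPochInf (q a : ℂ) : ℂ := ∏' j : ℕ, (1 - a * q ^ j)

open Finset Filter Topology

/-- Finite q-shifted factorial `(a;q)_n`. -/
noncomputable def qPochFin (q a : ℂ) (n : ℕ) : ℂ := ∏ k ∈ range n, (1 - a * q ^ k)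

/-- `1 / (q;q)_k` for an integer `k`, with the value `0` for negative `k`. -/
noncomputable def invQFactorial (q : ℂ) (k : ℤ) : ℂ :=
  if k < 0 then 0 else (qPochFin q q k.toNat)⁻¹

section qPochhammer

variable {q : ℂ}

theorem summable_norm_mul_pow (hq : ‖q‖ < 1) (a : ℂ) : Summable fun k : ℕ ↦ ‖-(a * q ^ k)‖ := by
  simpa using (summable_geometric_of_lt_one (norm_nonneg q) hq).mul_left ‖a‖

theorem tendsto_qPochFin (hq : ‖q‖ < 1) (a : ℂ) :
    Tendsto (qPochFin q a) atTop (𝓝 (qPochInf q a)) := by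
  have h := (multipliable_one_add_of_summable
    (summable_norm_mul_pow hq a)).tendsto_prod_tprod_nat
  simp only [← sub_eq_add_neg] at h
  exact h

theorem one_sub_pow_succ_ne_zero (hq : ‖q‖ < 1) (n : ℕ) : 1 - q ^ (n + 1) ≠ 0 := by
  intro h
  have h2 : ‖q ^ (n + 1)‖ < 1 := by
    rw [norm_pow]
    exact pow_lt_one₀ (norm_nonneg q) hq n.succ_ne_zero
  rw [← sub_eq_zero.1 h] at h2
  simp at h2

theorem qPochInf_self_ne_zero (hq : ‖q‖ < 1) : qPochInf q q ≠ 0 := by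
  have h := tprod_one_add_ne_zero_of_summable (f := fun k : ℕ ↦ -(q * q ^ k))
    (fun k ↦ by
      rw [← sub_eq_add_neg, ← pow_succ']
      exact one_sub_pow_succ_ne_zero hq k) (summable_norm_mul_pow hq q)
  simp only [← sub_eq_add_neg] at h
  exact h

theorem norm_qPochFin_le (hq : ‖q‖ < 1) {a : ℂ} (ha : ‖a‖ ≤ 1) (n : ℕ) :
    ‖qPochFin q a n‖ ≤ Real.exp (1 - ‖q‖)⁻¹ := by
  have h := Finset.norm_prod_one_add_sub_one_le (range n) fun k ↦ -(a * q ^ k)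
  simp only [← sub_eq_add_neg] at h
  have h1 : ‖qPochFin q a n‖ ≤ ‖qPochFin q a n - 1‖ + 1 := by
    simpa using norm_add_le (qPochFin q a n - 1) 1
  have h2 : ∑ k ∈ range n, ‖-(a * q ^ k)‖ ≤ (1 - ‖q‖)⁻¹ := by
    rw [← tsum_geometric_of_lt_one (norm_nonneg q) hq]
    refine le_trans (sum_le_sum fun k _ ↦ ?_)
      ((summable_geometric_of_lt_one (norm_nonneg q) hq).sum_le_tsum (range n)
        fun k _ ↦ by positivity)
    rw [norm_neg, norm_mul, norm_pow]
    exact mul_le_of_le_one_left (by positivity) ha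
  have h3 := Real.exp_le_exp.2 h2
  unfold qPochFin at h1 ⊢
  linarith

theorem qPochFin_succ (a : ℂ) (n : ℕ) :
    qPochFin q a (n + 1) = qPochFin q a n * (1 - a * q ^ n) :=
  prod_range_succ _ _

theorem qPochFin_succ' (a : ℂ) (n : ℕ) :
    qPochFin q a (n + 1) = (1 - a) * qPochFin q (q * a) n := by
  unfold qPochFin
  rw [prod_range_succ', pow_zero, mul_one, mul_comm]
  congr 1
  exact prod_congr rfl fun k _ ↦ by ring

theorem qPochFin_self_ne_zero (hq : ‖q‖ < 1) (n : ℕ) : qPochFin q q n ≠ 0 :=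
  prod_ne_zero_iff.2 fun k _ ↦ by
    rw [← pow_succ']
    exact one_sub_pow_succ_ne_zero hq k

theorem invQFactorial_sub_one (hq : ‖q‖ < 1) (k : ℤ) :
    invQFactorial q (k - 1) = (1 - q ^ k) * invQFactorial q k := by
  rcases lt_trichotomy k 0 with h | rfl | h
  · simp [invQFactorial, h, show k - 1 < 0 by omega]
  · simp [invQFactorial]
  · obtain ⟨n, rfl⟩ : ∃ n : ℕ, k = n + 1 := ⟨(k - 1).toNat, by omega⟩
    have h1 : ((n : ℤ) + 1).toNat = n + 1 := by omega
    have h2 := one_sub_pow_succ_ne_zero hq n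
    have h3 := qPochFin_self_ne_zero hq n
    simp only [invQFactorial, add_sub_cancel_right, h1, Int.toNat_natCast, qPochFin_succ,
      ← pow_succ', show ¬ (n : ℤ) < 0 by omega, show ¬ (n : ℤ) + 1 < 0 by omega, if_false]
    rw [show (q : ℂ) ^ ((n : ℤ) + 1) = q ^ (n + 1) by exact_mod_cast zpow_natCast q (n + 1)]
    field_simp

theorem tendsto_invQFactorial (hq : ‖q‖ < 1) (j : ℤ) :
    Tendsto (fun n : ℕ ↦ invQFactorial q (n + j)) atTop (𝓝 (qPochInf q q)⁻¹) := by
  have h : Tendsto (fun n : ℕ ↦ ((n : ℤ) + j).toNat) atTop atTop :=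
    tendsto_atTop.2 fun b ↦ by
      filter_upwards [eventually_ge_atTop (b + j.natAbs)] with n hn
      omega
  refine (((tendsto_qPochFin hq q).comp h).inv₀ (qPochInf_self_ne_zero hq)).congr' ?_
  filter_upwards [eventually_ge_atTop j.natAbs] with n hn
  simp [invQFactorial, show ¬ (n : ℤ) + j < 0 by omega]

end qPochhammer

theorem mul_add_one_ediv_two (j : ℤ) : j * (j + 1) / 2 = j * (j - 1) / 2 + j := by
  rw [← Int.add_mul_ediv_right _ _ two_ne_zero]
  congr 1
  ring

theorem exp_two_I_mul_zpow (j : ℤ) (θ : ℝ) :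
    exp (2 * I * θ) ^ j = exp (2 * I * j * θ) := by
  rw [← exp_int_mul]
  congr 1
  ring

theorem integral_exp_two_I_mul_zpow (j : ℤ) :
    ∫ θ : ℝ in (0)..Real.pi, exp (2 * I * θ) ^ j = if j = 0 then (Real.pi : ℂ) else 0 := by
  split_ifs with h
  · simp [h]
  · have hc : 2 * I * (j : ℂ) ≠ 0 := by simp [h]
    simp only [exp_two_I_mul_zpow]
    rw [integral_exp_mul_complex hc,
      show 2 * I * (j : ℂ) * Real.pi = j * (2 * Real.pi * I) by ring, exp_int_mul_two_pi_mul_I]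
    simp

/-- The moments of the truncated theta product, equivalent to the finite Jacobi triple product. -/
theorem integral_qPochFin_mul_qPochFin {q : ℂ} (hq0 : q ≠ 0) (hq : ‖q‖ < 1) (n : ℕ) (j : ℤ) :
    ∫ θ : ℝ in (0)..Real.pi, exp (2 * I * θ) ^ j *
        (qPochFin q (exp (2 * I * θ)) n * qPochFin q (q * (exp (2 * I * θ))⁻¹) n) =
      Real.pi * ((-1) ^ j * q ^ (j * (j + 1) / 2) * qPochFin q q (2 * n) *
        invQFactorial q (n + j) * invQFactorial q (n - j)) := by
  induction n generalizing j with
  | zero =>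
    simp only [qPochFin, range_zero, prod_empty, mul_one, integral_exp_two_I_mul_zpow]
    rcases lt_trichotomy j 0 with h | rfl | h
    · simp [invQFactorial, h, h.ne]
    · simp [invQFactorial, qPochFin]
    · simp [invQFactorial, h, h.ne']
  | succ n ih =>
    have hcont (i : ℤ) : IntervalIntegrable (fun θ : ℝ ↦ exp (2 * I * θ) ^ i *
        (qPochFin q (exp (2 * I * θ)) n * qPochFin q (q * (exp (2 * I * θ))⁻¹) n))
        MeasureTheory.volume 0 Real.pi := by
      apply Continuous.intervalIntegrable
      simp only [exp_two_I_mul_zpow, ← Complex.exp_neg, qPochFin]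
      fun_prop
    have hrec (θ : ℝ) : exp (2 * I * θ) ^ j * (qPochFin q (exp (2 * I * θ)) (n + 1) *
          qPochFin q (q * (exp (2 * I * θ))⁻¹) (n + 1)) =
        (1 + q ^ (2 * n + 1)) * (exp (2 * I * θ) ^ j *
          (qPochFin q (exp (2 * I * θ)) n * qPochFin q (q * (exp (2 * I * θ))⁻¹) n)) -
        q ^ n * (exp (2 * I * θ) ^ (j + 1) *
          (qPochFin q (exp (2 * I * θ)) n * qPochFin q (q * (exp (2 * I * θ))⁻¹) n)) -
        q ^ (n + 1) * (exp (2 * I * θ) ^ (j - 1) *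
          (qPochFin q (exp (2 * I * θ)) n * qPochFin q (q * (exp (2 * I * θ))⁻¹) n)) := by
      have hw := exp_ne_zero (2 * I * θ)
      rw [qPochFin_succ, qPochFin_succ, zpow_add_one₀ hw, zpow_sub_one₀ hw]
      field_simp
      ring
    simp only [hrec]
    rw [integral_sub (((hcont j).const_mul _).sub ((hcont (j + 1)).const_mul _))
      ((hcont (j - 1)).const_mul _), integral_sub ((hcont j).const_mul _)
      ((hcont (j + 1)).const_mul _)]
    simp only [integral_const_mul, ih]
    have e1 := invQFactorial_sub_one hq (n + 1 + j)
    have e2 := invQFactorial_sub_one hq (n + 1 - j)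
    have e3 := invQFactorial_sub_one hq (n + j)
    have e4 := invQFactorial_sub_one hq (n - j)
    rw [show (n : ℤ) + 1 + j - 1 = n + j by ring] at e1
    rw [show (n : ℤ) + 1 - j - 1 = n - j by ring] at e2
    rw [e1] at e3
    rw [e2] at e4
    have s1 : (j + 1) * (j + 1 + 1) / 2 = j * (j + 1) / 2 + (j + 1) := by
      rw [mul_add_one_ediv_two (j + 1), add_sub_cancel_right, mul_comm (j + 1)]
    have s2 : (j - 1) * (j - 1 + 1) / 2 = j * (j + 1) / 2 - j := by
      rw [mul_add_one_ediv_two j, sub_add_cancel, mul_comm (j - 1)]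
      ring
    rw [s1, s2, show (n : ℤ) + (j + 1) = n + 1 + j by ring,
      show (n : ℤ) - (j + 1) = n - j - 1 by ring, show (n : ℤ) + (j - 1) = n + j - 1 by ring,
      show (n : ℤ) - (j - 1) = n + 1 - j by ring, e3, e4, e1, e2,
      show 2 * (n + 1) = 2 * n + 1 + 1 by ring, qPochFin_succ, qPochFin_succ, Nat.cast_succ]
    have hneg : (-1 : ℂ) ≠ 0 := by norm_num
    simp only [zpow_add₀ hq0, zpow_sub₀ hq0, zpow_add₀ hneg, zpow_sub₀ hneg, zpow_one,
      zpow_natCast]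
    have hj : q ^ j ≠ 0 := zpow_ne_zero j hq0
    field_simp
    ring

theorem qHermite_trigonometric_moments (j : ℤ) (q : ℝ) (hq0 : 0 < q) (hq1 : q < 1) :
    (∫ θ : ℝ in (0)..Real.pi,
        Complex.exp (2 * Complex.I * j * θ) *
          qPochInf (q : ℂ) (Complex.exp (2 * Complex.I * θ)) *
          qPochInf (q : ℂ) (Complex.exp (-2 * Complex.I * θ))) / (2 * Real.pi) =
      (-1 : ℂ) ^ j *
        ((q : ℂ) ^ ((j * (j - 1)) / 2) + (q : ℂ) ^ ((j * (j + 1)) / 2)) /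
        (2 * qPochInf (q : ℂ) (q : ℂ)) := by
  have hq0' : (q : ℂ) ≠ 0 := by exact_mod_cast hq0.ne'
  have hq : ‖(q : ℂ)‖ < 1 := by simpa [abs_of_pos hq0] using hq1
  have hneg (θ : ℝ) : exp (-2 * I * θ) = (exp (2 * I * θ))⁻¹ := by
    rw [← Complex.exp_neg]
    congr 1
    ring
  have hnorm (θ : ℝ) : ‖exp (2 * I * θ)‖ = 1 := by
    rw [show 2 * I * (θ : ℂ) = ((2 * θ : ℝ) : ℂ) * I by push_cast; ring]
    exact norm_exp_ofReal_mul_I _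
  have hlim : Tendsto (fun n : ℕ ↦ ∫ θ : ℝ in (0)..Real.pi, exp (2 * I * j * θ) *
      qPochFin q (exp (2 * I * θ)) n * qPochFin q (exp (-2 * I * θ)) (n + 1)) atTop
      (𝓝 (∫ θ : ℝ in (0)..Real.pi, exp (2 * I * j * θ) *
        qPochInf q (exp (2 * I * θ)) * qPochInf q (exp (-2 * I * θ)))) := by
    refine tendsto_integral_filter_of_dominated_convergence
      (fun _ ↦ Real.exp (1 - ‖(q : ℂ)‖)⁻¹ * Real.exp (1 - ‖(q : ℂ)‖)⁻¹)
      (Eventually.of_forall fun n ↦ ?_) (Eventually.of_forall fun n ↦ ?_)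
      intervalIntegrable_const ?_
    · apply Continuous.aestronglyMeasurable
      unfold qPochFin
      fun_prop
    · refine Eventually.of_forall fun θ _ ↦ ?_
      rw [norm_mul, norm_mul, ← exp_two_I_mul_zpow, norm_zpow, hnorm, one_zpow, one_mul]
      gcongr
      · exact norm_qPochFin_le hq (hnorm θ).le n
      · exact norm_qPochFin_le hq (by rw [hneg, norm_inv, hnorm, inv_one]) (n + 1)
    · exact Eventually.of_forall fun θ _ ↦ (tendsto_const_nhds.mul (tendsto_qPochFin hq _)).mul
        ((tendsto_qPochFin hq _).comp (tendsto_add_atTop_nat 1))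
  have hmoment (i : ℤ) : Tendsto (fun n : ℕ ↦ ∫ θ : ℝ in (0)..Real.pi, exp (2 * I * θ) ^ i *
      (qPochFin q (exp (2 * I * θ)) n * qPochFin q (q * (exp (2 * I * θ))⁻¹) n)) atTop
      (𝓝 (Real.pi * ((-1) ^ i * (q : ℂ) ^ (i * (i + 1) / 2) / qPochInf q q))) := by
    simp only [integral_qPochFin_mul_qPochFin hq0' hq]
    have h2 : Tendsto (fun n : ℕ ↦ 2 * n) atTop atTop :=
      tendsto_id.const_mul_atTop' two_pos
    have h := ((((tendsto_qPochFin hq q).comp h2).const_mul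
      ((-1) ^ i * (q : ℂ) ^ (i * (i + 1) / 2))).mul (tendsto_invQFactorial hq i)).mul
      (tendsto_invQFactorial hq (-i))
    rw [mul_inv_cancel_right₀ (qPochInf_self_ne_zero hq), ← div_eq_mul_inv] at h
    exact h.const_mul (Real.pi : ℂ)
  have hsplit (n : ℕ) : ∫ θ : ℝ in (0)..Real.pi, exp (2 * I * j * θ) *
      qPochFin q (exp (2 * I * θ)) n * qPochFin q (exp (-2 * I * θ)) (n + 1) =
      (∫ θ : ℝ in (0)..Real.pi, exp (2 * I * θ) ^ j *
        (qPochFin q (exp (2 * I * θ)) n * qPochFin q (q * (exp (2 * I * θ))⁻¹) n)) -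
      ∫ θ : ℝ in (0)..Real.pi, exp (2 * I * θ) ^ (j - 1) *
        (qPochFin q (exp (2 * I * θ)) n * qPochFin q (q * (exp (2 * I * θ))⁻¹) n) := by
    rw [← integral_sub]
    · congr 1
      ext θ
      rw [qPochFin_succ', hneg, zpow_sub_one₀ (exp_ne_zero _), exp_two_I_mul_zpow]
      ring
    all_goals
      apply Continuous.intervalIntegrable
      simp only [exp_two_I_mul_zpow, ← Complex.exp_neg, qPochFin]
      fun_prop
  simp only [hsplit] at hlim
  rw [tendsto_nhds_unique hlim ((hmoment j).sub (hmoment (j - 1))), sub_add_cancel,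
    mul_comm (j - 1) j, zpow_sub_one₀ (by norm_num : (-1 : ℂ) ≠ 0)]
  have hpi : (Real.pi : ℂ) ≠ 0 := by exact_mod_cast Real.pi_ne_zero
  have := qPochInf_self_ne_zero hq
  field_simp
  ring
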